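/- arXiv:1602.05247 — 18 statements merged into one kernel-verified Lean document; each statement's English description precedes it below -/
import Mathlib

section
/- For any column vectors t and u, the matrix I − P + t u^T is invertible if and only if π^T t ≠ 0 and u^T e ≠ 0. -/
open Matrix

theorem stmt_0 {m : ℕ} (hm : 1 ≤ m)
    (P : Matrix (Fin m) (Fin m) ℝ) (π : Fin m → ℝ)
    (hP0 : ∀ i j, 0 ≤ P i j)
    (hPe : P *ᵥ 1 = 1)
    (hker : ∀ x : Fin m → ℝ, (1 - P) *ᵥ x = 0 → ∃ c : ℝ, x = c • (1 : Fin m → ℝ))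
    (hcoker : ∀ y : Fin m → ℝ, y ᵥ* (1 - P) = 0 → ∃ c : ℝ, y = c • π)
    (hπP : π ᵥ* P = π) (hπe : π ⬝ᵥ 1 = 1) (hπpos : ∀ i, 0 < π i)
    (t u : Fin m → ℝ) :
    IsUnit (1 - P + vecMulVec t u) ↔ π ⬝ᵥ t ≠ 0 ∧ u ⬝ᵥ 1 ≠ 0 := by
  have hA1 : (1 - P) *ᵥ (1 : Fin m → ℝ) = 0 := by rw [sub_mulVec, one_mulVec, hPe, sub_self]
  have hπA : π ᵥ* (1 - P) = 0 := by rw [vecMul_sub, vecMul_one, hπP, sub_self]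
  have hmul (x : Fin m → ℝ) :
      (1 - P + vecMulVec t u) *ᵥ x = (1 - P) *ᵥ x + (u ⬝ᵥ x) • t := by
    rw [add_mulVec, vecMulVec_mulVec, op_smul_eq_smul]
  constructor
  · intro h
    refine ⟨fun ht => ?_, fun hu => ?_⟩
    · have hπ0 : π = 0 := vecMul_injective_iff_isUnit.mpr h (by
        simp [vecMul_add, hπA, vecMul_vecMulVec, ht])
      exact (hπpos ⟨0, hm⟩).ne' (congrFun hπ0 _)
    · have h10 : (1 : Fin m → ℝ) = 0 := mulVec_injective_iff_isUnit.mpr h (by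
        simp [hmul, hA1, hu])
      exact one_ne_zero (congrFun h10 ⟨0, hm⟩)
  · rintro ⟨ht, hu⟩
    rw [← mulVec_injective_iff_isUnit]
    refine (injective_iff_map_eq_zero (1 - P + vecMulVec t u).mulVecLin).mpr fun x hx => ?_
    rw [mulVecLin_apply, hmul] at hx
    have hux : u ⬝ᵥ x = 0 := by
      have h := congrArg (π ⬝ᵥ ·) hx
      simpa [dotProduct_add, dotProduct_mulVec, hπA, ht] using h
    rw [hux, zero_smul, add_zero] at hx
    obtain ⟨c, rfl⟩ := hker x hx
    rw [dotProduct_smul, smul_eq_mul] at hux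
    rw [(mul_eq_zero.mp hux).resolve_right hu, zero_smul]
end

section
/- If t and u are column vectors with π^T t ≠ 0 and u^T e ≠ 0, then G = (I − P + t u^T)^{-1} is a one-condition g-inverse of A = I − P, i.e., (I − P) G (I − P) = I − P. -/
open Matrix

section RankOneUpdate

variable {n K : Type*} [Fintype n] [DecidableEq n] [Field K]
  {A : Matrix n n K} {p e t u : n → K}

/-- A rank-one update of a matrix whose kernel is spanned by `e` is invertible when the update
vectors are not orthogonal to `e` and to a left null vector `p`. -/
theorem isUnit_det_add_vecMulVec
    (hker : ∀ x, A *ᵥ x = 0 → ∃ c : K, x = c • e) (hp : p ᵥ* A = 0)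
    (ht : p ⬝ᵥ t ≠ 0) (hu : u ⬝ᵥ e ≠ 0) : IsUnit (A + vecMulVec t u).det := by
  rw [isUnit_iff_ne_zero]
  intro hdet
  obtain ⟨x, hx0, hx⟩ := exists_mulVec_eq_zero_iff.mpr hdet
  have hux : u ⬝ᵥ x = 0 := by
    have h := congrArg (p ⬝ᵥ ·) hx
    simpa [dotProduct_mulVec, vecMul_add, hp, vecMul_vecMulVec, ht] using h
  have hAx : A *ᵥ x = 0 := by
    simpa [add_mulVec, vecMulVec_mulVec, hux] using hx
  obtain ⟨c, rfl⟩ := hker x hAx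
  have hc : c = 0 := by simpa [hu] using hux
  exact hx0 (by simp [hc])

/-- If `p` is a left null vector of `A` with `p ⬝ᵥ t ≠ 0`, the inverse of an invertible rank-one
update `A + t uᵀ` is a generalized inverse of `A`. -/
theorem mul_inv_add_vecMulVec_mul_self (hp : p ᵥ* A = 0) (ht : p ⬝ᵥ t ≠ 0)
    (hM : IsUnit (A + vecMulVec t u).det) : A * (A + vecMulVec t u)⁻¹ * A = A := by
  set M := A + vecMulVec t u with hMdef
  have hpM : p ᵥ* M = (p ⬝ᵥ t) • u := by
    simp [hMdef, vecMul_add, hp, vecMul_vecMulVec]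
  have huG : (p ⬝ᵥ t) • (u ᵥ* M⁻¹) = p := by
    rw [← smul_vecMul, ← hpM, vecMul_vecMul, mul_nonsing_inv M hM, vecMul_one]
  have huGA : u ᵥ* M⁻¹ ᵥ* A = 0 := by
    have h : (p ⬝ᵥ t) • (u ᵥ* M⁻¹ ᵥ* A) = 0 := by rw [← smul_vecMul, huG, hp]
    exact (smul_eq_zero.mp h).resolve_left ht
  have hA : A = M - vecMulVec t u := by simp [hMdef]
  calc A * M⁻¹ * A = (M - vecMulVec t u) * M⁻¹ * A := by rw [← hA]
    _ = A := by
      rw [sub_mul, mul_nonsing_inv M hM, sub_mul, one_mul, vecMulVec_mul, vecMulVec_mul, huGA,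
        vecMulVec_zero, sub_zero]

end RankOneUpdate

theorem stmt_1 {m : ℕ} (hm : 1 ≤ m)
    (P : Matrix (Fin m) (Fin m) ℝ) (π : Fin m → ℝ)
    (hP0 : ∀ i j, 0 ≤ P i j)
    (hPe : P *ᵥ 1 = 1)
    (hker : ∀ x : Fin m → ℝ, (1 - P) *ᵥ x = 0 → ∃ c : ℝ, x = c • (1 : Fin m → ℝ))
    (hcoker : ∀ y : Fin m → ℝ, y ᵥ* (1 - P) = 0 → ∃ c : ℝ, y = c • π)
    (hπP : π ᵥ* P = π) (hπe : π ⬝ᵥ 1 = 1) (hπpos : ∀ i, 0 < π i)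
    (t u : Fin m → ℝ) (ht : π ⬝ᵥ t ≠ 0) (hu : u ⬝ᵥ 1 ≠ 0)
    (G : Matrix (Fin m) (Fin m) ℝ) (hG : G = (1 - P + vecMulVec t u)⁻¹) :
    (1 - P) * G * (1 - P) = 1 - P := by
  have hπ : π ᵥ* (1 - P) = 0 := by rw [vecMul_sub, vecMul_one, hπP, sub_self]
  rw [hG]
  exact mul_inv_add_vecMulVec_mul_self hπ ht (isUnit_det_add_vecMulVec hker hπ ht hu)
end

section
/- Let t and u be column vectors with π^T t ≠ 0 and u^T e ≠ 0. A matrix X satisfies (I − P) X (I − P) = I − P if and only if there exist column vectors f and g such that X = (I − P + t u^T)^{-1} + e f^T + g π^T. -/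
open Matrix

namespace RankOneUpdate

variable {n K : Type*} [Fintype n] [DecidableEq n] [Field K]
  {A : Matrix n n K} {e p t u : n → K}

lemma isUnit_det_add_vecMulVec (hker : ∀ x : n → K, A *ᵥ x = 0 → ∃ c : K, x = c • e)
    (hp : p ᵥ* A = 0) (ht : p ⬝ᵥ t ≠ 0) (hu : u ⬝ᵥ e ≠ 0) :
    IsUnit (A + vecMulVec t u).det := by
  rw [isUnit_iff_ne_zero]
  intro hdet
  obtain ⟨x, hx0, hx⟩ := exists_mulVec_eq_zero_iff.mpr hdet
  have hux : u ⬝ᵥ x = 0 := by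
    have h := congrArg (p ⬝ᵥ ·) hx
    simpa [dotProduct_mulVec, vecMul_add, hp, vecMul_vecMulVec, ht] using h
  have hAx : A *ᵥ x = 0 := by
    simpa [add_mulVec, vecMulVec_mulVec, hux] using hx
  obtain ⟨c, rfl⟩ := hker x hAx
  have hc : c = 0 := by simpa [hu] using hux
  exact hx0 (by simp [hc])

lemma mul_inv_add_vecMulVec (hB : IsUnit (A + vecMulVec t u).det)
    (hp : p ᵥ* A = 0) (ht : p ⬝ᵥ t ≠ 0) :
    A * (A + vecMulVec t u)⁻¹ = 1 - vecMulVec t ((p ⬝ᵥ t)⁻¹ • p) := by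
  have huB : u ᵥ* (A + vecMulVec t u)⁻¹ = (p ⬝ᵥ t)⁻¹ • p := by
    have h : ((p ⬝ᵥ t)⁻¹ • p) ᵥ* (A + vecMulVec t u) = u := by
      simp [vecMul_add, smul_vecMul, hp, vecMul_vecMulVec, ht]
    simpa [vecMul_vecMul, mul_nonsing_inv _ hB] using
      (congrArg (· ᵥ* (A + vecMulVec t u)⁻¹) h).symm
  have h := mul_nonsing_inv _ hB
  rw [add_mul, vecMulVec_mul, huB] at h
  exact eq_sub_of_add_eq h

lemma inv_add_vecMulVec_mul (hB : IsUnit (A + vecMulVec t u).det)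
    (he : A *ᵥ e = 0) (hu : u ⬝ᵥ e ≠ 0) :
    (A + vecMulVec t u)⁻¹ * A = 1 - vecMulVec ((u ⬝ᵥ e)⁻¹ • e) u := by
  have hBt : (A + vecMulVec t u)⁻¹ *ᵥ t = (u ⬝ᵥ e)⁻¹ • e := by
    have h : (A + vecMulVec t u) *ᵥ ((u ⬝ᵥ e)⁻¹ • e) = t := by
      simp [add_mulVec, mulVec_smul, he, vecMulVec_mulVec, smul_smul, hu]
    simpa [mulVec_mulVec, nonsing_inv_mul _ hB] using
      (congrArg ((A + vecMulVec t u)⁻¹ *ᵥ ·) h).symm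
  have h := nonsing_inv_mul _ hB
  rw [mul_add, mul_vecMulVec, hBt] at h
  exact eq_sub_of_add_eq h

lemma mul_inv_add_vecMulVec_mul (hB : IsUnit (A + vecMulVec t u).det)
    (hp : p ᵥ* A = 0) (ht : p ⬝ᵥ t ≠ 0) :
    A * (A + vecMulVec t u)⁻¹ * A = A := by
  rw [mul_inv_add_vecMulVec hB hp ht, sub_mul, one_mul, vecMulVec_mul, smul_vecMul, hp]
  simp

lemma exists_eq_vecMulVec_add_vecMulVec (hB : IsUnit (A + vecMulVec t u).det)
    (he : A *ᵥ e = 0) (hp : p ᵥ* A = 0) (ht : p ⬝ᵥ t ≠ 0) (hu : u ⬝ᵥ e ≠ 0)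
    {Y : Matrix n n K} (hY : A * Y * A = 0) :
    ∃ f g : n → K, Y = vecMulVec e f + vecMulVec g p := by
  set B := A + vecMulVec t u with hBdef
  have h : (1 - vecMulVec ((u ⬝ᵥ e)⁻¹ • e) u) * Y *
      (1 - vecMulVec t ((p ⬝ᵥ t)⁻¹ • p)) = 0 := by
    rw [← mul_inv_add_vecMulVec hB hp ht, ← inv_add_vecMulVec_mul hB he hu, ← hBdef]
    calc B⁻¹ * A * Y * (A * B⁻¹) = B⁻¹ * (A * Y * A) * B⁻¹ := by simp only [Matrix.mul_assoc]
      _ = 0 := by rw [hY]; simp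
  set Z := (1 - vecMulVec ((u ⬝ᵥ e)⁻¹ • e) u) * Y with hZ
  refine ⟨(u ⬝ᵥ e)⁻¹ • (u ᵥ* Y), (p ⬝ᵥ t)⁻¹ • (Z *ᵥ t), ?_⟩
  rw [mul_sub, mul_one, mul_vecMulVec, sub_eq_zero, vecMulVec_smul, ← smul_vecMulVec] at h
  rw [← h, hZ, sub_mul, one_mul, vecMulVec_mul, vecMulVec_smul, smul_vecMulVec]
  abel

end RankOneUpdate

theorem stmt_3 {m : ℕ} (hm : 1 ≤ m)
    (P : Matrix (Fin m) (Fin m) ℝ) (π : Fin m → ℝ)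
    (hP0 : ∀ i j, 0 ≤ P i j)
    (hPe : P *ᵥ 1 = 1)
    (hker : ∀ x : Fin m → ℝ, (1 - P) *ᵥ x = 0 → ∃ c : ℝ, x = c • (1 : Fin m → ℝ))
    (hcoker : ∀ y : Fin m → ℝ, y ᵥ* (1 - P) = 0 → ∃ c : ℝ, y = c • π)
    (hπP : π ᵥ* P = π) (hπe : π ⬝ᵥ 1 = 1) (hπpos : ∀ i, 0 < π i)
    (t u : Fin m → ℝ) (ht : π ⬝ᵥ t ≠ 0) (hu : u ⬝ᵥ 1 ≠ 0)
    (X : Matrix (Fin m) (Fin m) ℝ) :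
    (1 - P) * X * (1 - P) = 1 - P ↔
      ∃ f g : Fin m → ℝ,
        X = (1 - P + vecMulVec t u)⁻¹ + vecMulVec 1 f + vecMulVec g π := by
  have he : (1 - P) *ᵥ (1 : Fin m → ℝ) = 0 := by rw [sub_mulVec, one_mulVec, hPe, sub_self]
  have hp : π ᵥ* (1 - P) = 0 := by rw [vecMul_sub, vecMul_one, hπP, sub_self]
  have hB := RankOneUpdate.isUnit_det_add_vecMulVec hker hp ht hu
  have hG := RankOneUpdate.mul_inv_add_vecMulVec_mul hB hp ht
  constructor
  · intro hX
    obtain ⟨f, g, hfg⟩ := RankOneUpdate.exists_eq_vecMulVec_add_vecMulVec hB he hp ht hu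
      (Y := X - (1 - P + vecMulVec t u)⁻¹) (by rw [mul_sub (1 - P), sub_mul _ _ (1 - P), hX, hG, sub_self])
    exact ⟨f, g, by rw [add_assoc, ← hfg, add_sub_cancel]⟩
  · rintro ⟨f, g, rfl⟩
    rw [mul_add, mul_add, add_mul, add_mul, hG, mul_vecMulVec, mul_vecMulVec, he,
      vecMulVec_mul, vecMulVec_mul, hp]
    simp
end

section
/- Let G be a one-condition g-inverse of A = I − P. Define α = (I − A G) e, β^T = π^T (I − G A), and γ = β^T G α − 1. Then π^T α = 1, β^T e = 1, I − A G = α π^T, I − G A = e β^T, the matrix I − P + α β^T is invertible, and G = (I − P + α β^T)^{-1} + γ e π^T. -/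
open Matrix

/-- If the left null space of `A` is spanned by `π` and `D * A = 0`, where `π ⬝ᵥ e = 1`, then
`D` is the rank-one matrix with column factor `D *ᵥ e` and row factor `π`. -/
theorem eq_vecMulVec_mulVec_of_mul_eq_zero {n R : Type*} [Fintype n] [CommSemiring R]
    {A D : Matrix n n R} {π e : n → R}
    (hA : ∀ y : n → R, y ᵥ* A = 0 → ∃ c : R, y = c • π) (hπe : π ⬝ᵥ e = 1) (hD : D * A = 0) :
    D = vecMulVec (D *ᵥ e) π := by
  ext i j
  obtain ⟨c, hc⟩ := hA (D i) (by rw [← mul_apply_eq_vecMul, hD]; rfl)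
  have hce : (D *ᵥ e) i = c := by
    change D i ⬝ᵥ e = c
    rw [hc, smul_dotProduct, hπe, smul_eq_mul, mul_one]
  rw [vecMulVec_apply, hce, hc, Pi.smul_apply, smul_eq_mul]

/-- If the right null space of `A` is spanned by `e` and `A * D = 0`, where `π ⬝ᵥ e = 1`, then
`D` is the rank-one matrix with column factor `e` and row factor `π ᵥ* D`. -/
theorem eq_vecMulVec_vecMul_of_mul_eq_zero {n R : Type*} [Fintype n] [CommSemiring R]
    {A D : Matrix n n R} {π e : n → R}
    (hA : ∀ x : n → R, A *ᵥ x = 0 → ∃ c : R, x = c • e) (hπe : π ⬝ᵥ e = 1) (hD : A * D = 0) :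
    D = vecMulVec e (π ᵥ* D) := by
  have h := eq_vecMulVec_mulVec_of_mul_eq_zero (A := Aᵀ) (D := Dᵀ) (π := e) (e := π)
    (by simpa only [vecMul_transpose] using hA) (by rwa [dotProduct_comm])
    (by rw [← transpose_mul, hD, transpose_zero])
  rw [mulVec_transpose] at h
  rw [← transpose_inj, h, transpose_vecMulVec]

theorem stmt_4 {m : ℕ} (hm : 1 ≤ m)
    (P : Matrix (Fin m) (Fin m) ℝ) (π : Fin m → ℝ)
    (hP0 : ∀ i j, 0 ≤ P i j)
    (hPe : P *ᵥ 1 = 1)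
    (hker : ∀ x : Fin m → ℝ, (1 - P) *ᵥ x = 0 → ∃ c : ℝ, x = c • (1 : Fin m → ℝ))
    (hcoker : ∀ y : Fin m → ℝ, y ᵥ* (1 - P) = 0 → ∃ c : ℝ, y = c • π)
    (hπP : π ᵥ* P = π) (hπe : π ⬝ᵥ 1 = 1) (hπpos : ∀ i, 0 < π i)
    (G : Matrix (Fin m) (Fin m) ℝ) (hG : (1 - P) * G * (1 - P) = 1 - P)
    (α β : Fin m → ℝ) (γ : ℝ)
    (hα : α = (1 - (1 - P) * G) *ᵥ 1)
    (hβ : β = π ᵥ* (1 - G * (1 - P)))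
    (hγ : γ = β ⬝ᵥ (G *ᵥ α) - 1) :
    π ⬝ᵥ α = 1 ∧ β ⬝ᵥ 1 = 1 ∧
    1 - (1 - P) * G = vecMulVec α π ∧
    1 - G * (1 - P) = vecMulVec 1 β ∧
    IsUnit (1 - P + vecMulVec α β) ∧
    G = (1 - P + vecMulVec α β)⁻¹ + γ • vecMulVec 1 π := by
  have hAe : (1 - P) *ᵥ (1 : Fin m → ℝ) = 0 := by rw [sub_mulVec, one_mulVec, hPe, sub_self]
  have hπA : π ᵥ* (1 - P) = 0 := by rw [vecMul_sub, vecMul_one, hπP, sub_self]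
  generalize 1 - P = A at *
  have hAG : 1 - A * G = vecMulVec α π := by
    rw [hα]
    exact eq_vecMulVec_mulVec_of_mul_eq_zero hcoker hπe (by rw [sub_mul, hG, one_mul, sub_self])
  have hGA : 1 - G * A = vecMulVec 1 β := by
    rw [hβ]
    exact eq_vecMulVec_vecMul_of_mul_eq_zero hker hπe
      (by rw [mul_sub, ← mul_assoc, hG, mul_one, sub_self])
  have hπα : π ⬝ᵥ α = 1 := by
    rw [hα, dotProduct_mulVec, vecMul_sub, vecMul_one, ← vecMul_vecMul, hπA, zero_vecMul,
      sub_zero, hπe]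
  have hβe : β ⬝ᵥ 1 = 1 := by
    rw [hβ, ← dotProduct_mulVec, sub_mulVec, one_mulVec, ← mulVec_mulVec, hAe, mulVec_zero,
      sub_zero, hπe]
  have hβG : β ᵥ* G = (γ + 1) • π := by
    obtain ⟨c, hc⟩ := hcoker (β ᵥ* G) (by
      rw [vecMul_vecMul, ← sub_sub_cancel 1 (G * A), hGA, vecMul_sub, vecMul_one,
        vecMul_vecMulVec, hβe, one_smul, sub_self])
    rw [hγ, sub_add_cancel, dotProduct_mulVec, hc, smul_dotProduct, hπα, smul_eq_mul, mul_one]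
  have hinv : (A + vecMulVec α β) * (G - γ • vecMulVec 1 π) = 1 := by
    rw [add_mul, mul_sub, mul_sub, Matrix.mul_smul, Matrix.mul_smul, mul_vecMulVec,
      hAe, zero_vecMulVec, smul_zero, sub_zero, vecMulVec_mul, hβG, vecMulVec_mul_vecMulVec, hβe,
      one_smul, ← vecMulVec_smul, ← vecMulVec_sub, add_smul, one_smul, add_sub_cancel_left, ← hAG,
      add_sub_cancel]
  exact ⟨hπα, hβe, hAG, hGA, IsUnit.of_mul_eq_one _ hinv, by
    rw [inv_eq_right_inv hinv, sub_add_cancel]⟩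
end

section
/- Let G be a one-condition g-inverse of A = I − P, and define α = (I − A G) e, β^T = π^T (I − G A), and γ = β^T G α − 1. Then G A G = G if and only if γ = −1. -/
open Matrix

/-- A matrix whose rows are left null vectors of `A` is `(M *ᵥ e) πᵀ`, when the left null space
of `A` is spanned by `π` and `π ⬝ᵥ e = 1`. -/
lemma eq_vecMulVec_of_mul_eq_zero {n : Type*} [Fintype n] {A M : Matrix n n ℝ} {π e : n → ℝ}
    (hA : ∀ y : n → ℝ, y ᵥ* A = 0 → ∃ c : ℝ, y = c • π) (hπe : π ⬝ᵥ e = 1) (hM : M * A = 0) :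
    M = vecMulVec (M *ᵥ e) π := by
  ext i j
  obtain ⟨c, hc⟩ := hA (M i) (by
    ext k
    exact congrFun (congrFun hM i) k)
  rw [vecMulVec_apply, mulVec, hc, smul_dotProduct, hπe, Pi.smul_apply, smul_eq_mul, smul_eq_mul,
    mul_one]

/-- A matrix whose columns are right null vectors of `A` is `e (π ᵥ* M)`, when the right null space
of `A` is spanned by `e` and `π ⬝ᵥ e = 1`. -/
lemma eq_vecMulVec_of_mul_eq_zero' {n : Type*} [Fintype n] {A M : Matrix n n ℝ} {π e : n → ℝ}
    (hA : ∀ x : n → ℝ, A *ᵥ x = 0 → ∃ c : ℝ, x = c • e) (hπe : π ⬝ᵥ e = 1) (hM : A * M = 0) :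
    M = vecMulVec e (π ᵥ* M) := by
  have h := eq_vecMulVec_of_mul_eq_zero (A := Aᵀ) (M := Mᵀ) (π := e) (e := π)
    (fun y hy => hA y (by rwa [vecMul_transpose] at hy)) (by rwa [dotProduct_comm])
    (by rw [← transpose_mul, hM, transpose_zero])
  rwa [mulVec_transpose, ← transpose_vecMulVec, transpose_inj] at h

theorem stmt_5 {m : ℕ} (hm : 1 ≤ m)
    (P : Matrix (Fin m) (Fin m) ℝ) (π : Fin m → ℝ)
    (hP0 : ∀ i j, 0 ≤ P i j)
    (hPe : P *ᵥ 1 = 1)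
    (hker : ∀ x : Fin m → ℝ, (1 - P) *ᵥ x = 0 → ∃ c : ℝ, x = c • (1 : Fin m → ℝ))
    (hcoker : ∀ y : Fin m → ℝ, y ᵥ* (1 - P) = 0 → ∃ c : ℝ, y = c • π)
    (hπP : π ᵥ* P = π) (hπe : π ⬝ᵥ 1 = 1) (hπpos : ∀ i, 0 < π i)
    (G : Matrix (Fin m) (Fin m) ℝ) (hG : (1 - P) * G * (1 - P) = 1 - P)
    (α β : Fin m → ℝ) (γ : ℝ)
    (hα : α = (1 - (1 - P) * G) *ᵥ 1)
    (hβ : β = π ᵥ* (1 - G * (1 - P)))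
    (hγ : γ = β ⬝ᵥ (G *ᵥ α) - 1) :
    G * (1 - P) * G = G ↔ γ = -1 := by
  generalize 1 - P = A at *
  have hl : 1 - A * G = vecMulVec α π :=
    hα ▸ eq_vecMulVec_of_mul_eq_zero hcoker hπe (by rw [sub_mul, hG, one_mul, sub_self])
  have hr : 1 - G * A = vecMulVec 1 β :=
    hβ ▸ eq_vecMulVec_of_mul_eq_zero' hker hπe
      (by rw [mul_sub, ← mul_assoc, hG, mul_one, sub_self])
  have hdiff : G - G * A * G = (γ + 1) • vecMulVec 1 π := by
    calc G - G * A * G = G - G * A * G - G * A * G + G * (A * G * A) * G := by rw [hG]; abel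
      _ = (1 - G * A) * G * (1 - A * G) := by noncomm_ring
      _ = (γ + 1) • vecMulVec 1 π := by
        rw [hl, hr, mul_assoc, mul_vecMulVec, vecMulVec_mul_vecMulVec, hγ, sub_add_cancel]
        ext i j
        simp [vecMulVec_apply]
  have hne : vecMulVec (1 : Fin m → ℝ) π ≠ 0 := fun h =>
    (hπpos ⟨0, hm⟩).ne' (by simpa [vecMulVec_apply] using congrFun (congrFun h ⟨0, hm⟩) ⟨0, hm⟩)
  rw [eq_comm, ← sub_eq_zero, hdiff, smul_eq_zero_iff_left hne, add_eq_zero_iff_eq_neg]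
end

section
/- Let G be a one-condition g-inverse of A = I − P. Then there exists a scalar g with G e = g e if and only if (I − P) G = I − e π^T. Moreover, if G e = g e for some scalar g, then g = 1 + γ, where γ = β^T G α − 1 with α = (I − A G) e and β^T = π^T (I − G A). -/
open Matrix

/-- If the left kernel of `A` is spanned by `π`, then `1 - A * G`, for `G` a g-inverse of `A`, has
rank one with row direction `π`. -/
theorem one_sub_mul_eq_vecMulVec {n : Type*} [Fintype n] [DecidableEq n] {A G : Matrix n n ℝ}
    {π : n → ℝ} (hG : A * G * A = A)
    (hcoker : ∀ y : n → ℝ, y ᵥ* A = 0 → ∃ c : ℝ, y = c • π) (hπe : π ⬝ᵥ 1 = 1) :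
    1 - A * G = vecMulVec ((1 - A * G) *ᵥ 1) π := by
  have hzero : (1 - A * G) * A = 0 := by rw [sub_mul, one_mul, hG, sub_self]
  ext i j
  obtain ⟨c, hc⟩ := hcoker ((1 - A * G) i) (by
    ext k
    exact congrFun (congrFun hzero i) k)
  have hci : ((1 - A * G) *ᵥ 1) i = c := by
    rw [mulVec, hc, smul_dotProduct, hπe, smul_eq_mul, mul_one]
  rw [vecMulVec_apply, hci, hc, Pi.smul_apply, smul_eq_mul]

theorem stmt_7 {m : ℕ} (hm : 1 ≤ m)
    (P : Matrix (Fin m) (Fin m) ℝ) (π : Fin m → ℝ)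
    (hP0 : ∀ i j, 0 ≤ P i j)
    (hPe : P *ᵥ 1 = 1)
    (hker : ∀ x : Fin m → ℝ, (1 - P) *ᵥ x = 0 → ∃ c : ℝ, x = c • (1 : Fin m → ℝ))
    (hcoker : ∀ y : Fin m → ℝ, y ᵥ* (1 - P) = 0 → ∃ c : ℝ, y = c • π)
    (hπP : π ᵥ* P = π) (hπe : π ⬝ᵥ 1 = 1) (hπpos : ∀ i, 0 < π i)
    (G : Matrix (Fin m) (Fin m) ℝ) (hG : (1 - P) * G * (1 - P) = 1 - P)
    (α β : Fin m → ℝ) (γ : ℝ)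
    (hα : α = (1 - (1 - P) * G) *ᵥ 1)
    (hβ : β = π ᵥ* (1 - G * (1 - P)))
    (hγ : γ = β ⬝ᵥ (G *ᵥ α) - 1) :
    ((∃ g : ℝ, G *ᵥ 1 = g • (1 : Fin m → ℝ)) ↔ (1 - P) * G = 1 - vecMulVec 1 π) ∧
    (∀ g : ℝ, G *ᵥ 1 = g • (1 : Fin m → ℝ) → g = 1 + γ) := by
  have hAe : (1 - P) *ᵥ (1 : Fin m → ℝ) = 0 := by rw [sub_mulVec, one_mulVec, hPe, sub_self]
  have hα_one : ∀ g : ℝ, G *ᵥ 1 = g • (1 : Fin m → ℝ) → α = 1 := fun g hg => by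
    rw [hα, sub_mulVec, one_mulVec, ← mulVec_mulVec, hg, mulVec_smul, hAe, smul_zero, sub_zero]
  refine ⟨⟨?_, fun h => hker _ ?_⟩, fun g hg => ?_⟩
  · rintro ⟨g, hg⟩
    have h := one_sub_mul_eq_vecMulVec hG hcoker hπe
    rw [← hα, hα_one g hg] at h
    rw [← h, sub_sub_cancel]
  · rw [mulVec_mulVec, h, sub_mulVec, one_mulVec, vecMulVec_mulVec, hπe]
    simp
  · have hβe : β ⬝ᵥ 1 = 1 := by
      rw [hβ, ← dotProduct_mulVec, sub_mulVec, one_mulVec, ← mulVec_mulVec, hAe, mulVec_zero,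
        sub_zero, hπe]
    rw [hγ, hα_one g hg, hg, dotProduct_smul, hβe, smul_eq_mul, mul_one, add_sub_cancel]
end

section
/- Let G be a one-condition g-inverse of A = I − P. Then there exists a scalar h with π^T G = h π^T if and only if G (I − P) = I − e π^T. Moreover, if π^T G = h π^T for some scalar h, then h = 1 + γ, where γ = β^T G α − 1 with α = (I − A G) e and β^T = π^T (I − G A). -/
open Matrix

/-- If the kernel of `A` is spanned by the all-ones vector and `π` has total mass one, then a right
annihilator `M` of `A` has constant columns, with values given by `π ᵥ* M`. -/
theorem eq_vecMulVec_one_vecMul_of_mul_eq_zero {n R : Type*} [Fintype n] [CommRing R]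
    {A M : Matrix n n R} {π : n → R}
    (hker : ∀ x : n → R, A *ᵥ x = 0 → ∃ c : R, x = c • (1 : n → R))
    (hπ : π ⬝ᵥ 1 = 1) (hAM : A * M = 0) : M = vecMulVec 1 (π ᵥ* M) := by
  ext i j
  obtain ⟨c, hc⟩ := hker (M.col j) (funext fun k => congrFun (congrFun hAM k) j)
  have hMij : M i j = c := by simpa using congrFun hc i
  have hπM : (π ᵥ* M) j = c := by
    change π ⬝ᵥ M.col j = c
    rw [hc, dotProduct_smul, hπ, smul_eq_mul, mul_one]
  simp [vecMulVec_apply, hMij, hπM]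

theorem stmt_8 {m : ℕ} (hm : 1 ≤ m)
    (P : Matrix (Fin m) (Fin m) ℝ) (π : Fin m → ℝ)
    (hP0 : ∀ i j, 0 ≤ P i j)
    (hPe : P *ᵥ 1 = 1)
    (hker : ∀ x : Fin m → ℝ, (1 - P) *ᵥ x = 0 → ∃ c : ℝ, x = c • (1 : Fin m → ℝ))
    (hcoker : ∀ y : Fin m → ℝ, y ᵥ* (1 - P) = 0 → ∃ c : ℝ, y = c • π)
    (hπP : π ᵥ* P = π) (hπe : π ⬝ᵥ 1 = 1) (hπpos : ∀ i, 0 < π i)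
    (G : Matrix (Fin m) (Fin m) ℝ) (hG : (1 - P) * G * (1 - P) = 1 - P)
    (α β : Fin m → ℝ) (γ : ℝ)
    (hα : α = (1 - (1 - P) * G) *ᵥ 1)
    (hβ : β = π ᵥ* (1 - G * (1 - P)))
    (hγ : γ = β ⬝ᵥ (G *ᵥ α) - 1) :
    ((∃ h : ℝ, π ᵥ* G = h • π) ↔ G * (1 - P) = 1 - vecMulVec 1 π) ∧
    (∀ h : ℝ, π ᵥ* G = h • π → h = 1 + γ) := by
  have hπA : π ᵥ* (1 - P) = 0 := by rw [vecMul_sub, vecMul_one, hπP, sub_self]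
  have hβπ : ∀ h : ℝ, π ᵥ* G = h • π → π ᵥ* (1 - G * (1 - P)) = π := fun h hh => by
    rw [vecMul_sub, vecMul_one, ← vecMul_vecMul, hh, smul_vecMul, hπA, smul_zero, sub_zero]
  refine ⟨⟨?_, fun hGA => ?_⟩, fun h hh => ?_⟩
  · rintro ⟨h, hh⟩
    have hM : (1 - P) * (1 - G * (1 - P)) = 0 := by
      rw [mul_sub, mul_one, ← mul_assoc, hG, sub_self]
    have hone := eq_vecMulVec_one_vecMul_of_mul_eq_zero hker hπe hM
    rw [hβπ h hh] at hone
    rw [← hone, sub_sub_cancel]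
  · apply hcoker
    rw [vecMul_vecMul, hGA, vecMul_sub, vecMul_one, vecMul_vecMulVec, hπe]
    simp
  · have hπα : π ⬝ᵥ α = 1 := by
      rw [hα, dotProduct_mulVec, vecMul_sub, vecMul_one, ← vecMul_vecMul, hπA, zero_vecMul,
        sub_zero, hπe]
    rw [hγ, hβ, hβπ h hh, dotProduct_mulVec, hh, smul_dotProduct, hπα]
    simp
end

section
/- A matrix X satisfies the three group-inverse conditions A X A = A, X A X = X and A X = X A (with A = I − P) if and only if it satisfies the four properties (I − P) X = I − e π^T, X (I − P) = I − e π^T, X e = 0 and π^T X = 0^T. Moreover, there is exactly one such matrix X: the matrix I − P + e π^T is invertible and X = (I − P + e π^T)^{-1} − e π^T. -/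
open Matrix

section GroupInverse

variable {R : Type*} [Ring R] {A E X B : R}

theorem groupInverse_iff_of_idempotent (hAE : A * E = 0) (hEA : E * A = 0)
    (hker : ∀ Y, A * Y = 0 → E * Y = Y) :
    (A * X * A = A ∧ X * A * X = X ∧ A * X = X * A) ↔
      (A * X = 1 - E ∧ X * A = 1 - E ∧ X * E = 0 ∧ E * X = 0) := by
  constructor
  · rintro ⟨h1, h2, h3⟩
    have hE : E * (1 - X * A) = 1 - X * A :=
      hker _ (by rw [mul_sub, mul_one, ← mul_assoc, h1, sub_self])
    rw [mul_sub, mul_one, ← h3, ← mul_assoc, hEA, zero_mul, sub_zero] at hE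
    have hAX : A * X = 1 - E := by rw [hE]; abel
    refine ⟨hAX, h3 ▸ hAX, ?_, ?_⟩
    · rw [← h2, mul_assoc X, h3, mul_assoc, mul_assoc, hAE, mul_zero, mul_zero]
    · rw [← h2, ← h3, ← mul_assoc, ← mul_assoc, hEA, zero_mul, zero_mul]
  · rintro ⟨h1, h2, h3, -⟩
    refine ⟨?_, ?_, h1.trans h2.symm⟩
    · rw [h1, sub_mul, one_mul, hEA, sub_zero]
    · rw [mul_assoc, h1, mul_sub, mul_one, h3, sub_zero]

theorem add_mul_add_eq_one_of_groupInverse (hAE : A * E = 0) (hE : E * E = E)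
    (hAX : A * X = 1 - E) (hEX : E * X = 0) : (A + E) * (X + E) = 1 := by
  rw [add_mul, mul_add, mul_add, hAX, hAE, hEX, hE]
  abel

theorem groupInverse_properties_of_inverse_add (hAE : A * E = 0) (hEA : E * A = 0)
    (hE : E * E = E) (hl : (A + E) * B = 1) (hr : B * (A + E) = 1) :
    A * (B - E) = 1 - E ∧ (B - E) * A = 1 - E ∧ (B - E) * E = 0 ∧ E * (B - E) = 0 := by
  have hBE : B * E = E := by
    calc B * E = B * ((A + E) * E) := by rw [add_mul, hAE, hE, zero_add]
      _ = E := by rw [← mul_assoc, hr, one_mul]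
  have hEB : E * B = E := by
    calc E * B = E * (A + E) * B := by rw [mul_add, hEA, hE, zero_add]
      _ = E := by rw [mul_assoc, hl, mul_one]
  rw [add_mul, hEB] at hl
  rw [mul_add, hBE] at hr
  refine ⟨?_, ?_, ?_, ?_⟩
  · rw [mul_sub, hAE, sub_zero, eq_sub_of_add_eq hl]
  · rw [sub_mul, hEA, sub_zero, eq_sub_of_add_eq hr]
  · rw [sub_mul, hBE, hE, sub_self]
  · rw [mul_sub, hEB, hE, sub_self]

end GroupInverse

theorem stmt_9 {m : ℕ} (hm : 1 ≤ m)
    (P : Matrix (Fin m) (Fin m) ℝ) (π : Fin m → ℝ)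
    (hP0 : ∀ i j, 0 ≤ P i j)
    (hPe : P *ᵥ 1 = 1)
    (hker : ∀ x : Fin m → ℝ, (1 - P) *ᵥ x = 0 → ∃ c : ℝ, x = c • (1 : Fin m → ℝ))
    (hcoker : ∀ y : Fin m → ℝ, y ᵥ* (1 - P) = 0 → ∃ c : ℝ, y = c • π)
    (hπP : π ᵥ* P = π) (hπe : π ⬝ᵥ 1 = 1) (hπpos : ∀ i, 0 < π i) :
    (∀ X : Matrix (Fin m) (Fin m) ℝ,
      ((1 - P) * X * (1 - P) = 1 - P ∧ X * (1 - P) * X = X ∧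
        (1 - P) * X = X * (1 - P)) ↔
      ((1 - P) * X = 1 - vecMulVec 1 π ∧ X * (1 - P) = 1 - vecMulVec 1 π ∧
        X *ᵥ 1 = 0 ∧ π ᵥ* X = 0)) ∧
    IsUnit (1 - P + vecMulVec 1 π) ∧
    (∃! X : Matrix (Fin m) (Fin m) ℝ,
      (1 - P) * X * (1 - P) = 1 - P ∧ X * (1 - P) * X = X ∧
        (1 - P) * X = X * (1 - P)) ∧
    (∀ X : Matrix (Fin m) (Fin m) ℝ,
      ((1 - P) * X * (1 - P) = 1 - P ∧ X * (1 - P) * X = X ∧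
        (1 - P) * X = X * (1 - P)) →
      X = (1 - P + vecMulVec 1 π)⁻¹ - vecMulVec 1 π) := by
  have hone : (1 : Fin m → ℝ) ≠ 0 := by
    intro h
    simp [h] at hπe
  have hπ0 : π ≠ 0 := by
    rintro rfl
    simp at hπe
  set A := 1 - P with hA
  set E := vecMulVec (1 : Fin m → ℝ) π with hEdef
  have hAE : A * E = 0 := by
    rw [hEdef, mul_vecMulVec, hA, sub_mulVec, one_mulVec, hPe, sub_self, zero_vecMulVec]
  have hEA : E * A = 0 := by
    rw [hEdef, vecMulVec_mul, hA, vecMul_sub, vecMul_one, hπP, sub_self, vecMulVec_zero]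
  have hEv (v : Fin m → ℝ) : E *ᵥ v = (π ⬝ᵥ v) • (1 : Fin m → ℝ) := by
    rw [hEdef, vecMulVec_mulVec, op_smul_eq_smul]
  have hEE : E * E = E := by
    nth_rw 2 [hEdef]
    rw [mul_vecMulVec, hEv, hπe, one_smul]
  have hkerv (v : Fin m → ℝ) (hv : A *ᵥ v = 0) : E *ᵥ v = v := by
    obtain ⟨c, rfl⟩ := hker v hv
    rw [mulVec_smul, hEv, hπe, one_smul]
  have hkerM (Y : Matrix (Fin m) (Fin m) ℝ) (hY : A * Y = 0) : E * Y = Y := by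
    refine ext_of_mulVec_single fun i => ?_
    rw [← mulVec_mulVec]
    exact hkerv _ (by rw [mulVec_mulVec, hY, zero_mulVec])
  have hXE (X : Matrix (Fin m) (Fin m) ℝ) : X * E = 0 ↔ X *ᵥ 1 = 0 := by
    rw [hEdef, mul_vecMulVec, vecMulVec_eq_zero, or_iff_left hπ0]
  have hEX (X : Matrix (Fin m) (Fin m) ℝ) : E * X = 0 ↔ π ᵥ* X = 0 := by
    rw [hEdef, vecMulVec_mul, vecMulVec_eq_zero, or_iff_right hone]
  have hiff (X : Matrix (Fin m) (Fin m) ℝ) :=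
    groupInverse_iff_of_idempotent (X := X) hAE hEA hkerM
  have hunit : IsUnit (A + E) := by
    rw [← mulVec_injective_iff_isUnit]
    refine (injective_iff_map_eq_zero (A + E).mulVecLin).2 fun v hv => ?_
    rw [mulVecLin_apply] at hv
    have hEv0 : E *ᵥ v = 0 := by
      have h := congrArg (E *ᵥ ·) hv
      simpa only [mulVec_mulVec, mul_add, hEA, hEE, zero_add, mulVec_zero] using h
    rw [add_mulVec, hEv0, add_zero] at hv
    rw [← hkerv v hv, hEv0]
  have huniq (X : Matrix (Fin m) (Fin m) ℝ)
      (hX : A * X * A = A ∧ X * A * X = X ∧ A * X = X * A) : X = (A + E)⁻¹ - E := by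
    obtain ⟨h1, -, -, h4⟩ := (hiff X).1 hX
    rw [inv_eq_right_inv (add_mul_add_eq_one_of_groupInverse hAE hEE h1 h4), add_sub_cancel_right]
  have hdet := (isUnit_iff_isUnit_det _).1 hunit
  refine ⟨fun X => ?_, hunit, ⟨(A + E)⁻¹ - E, ?_, huniq⟩, huniq⟩
  · rw [hiff, hXE, hEX]
  · exact (hiff _).2 (groupInverse_properties_of_inverse_add hAE hEA hEE
      (mul_nonsing_inv _ hdet) (nonsing_inv_mul _ hdet))
end

section
/- Let G be a one-condition g-inverse of A = I − P and set H = G (I − Π) and β^T = π^T (I − G A). Then H is a one-condition g-inverse of A (i.e., A H A = A) with H e = 0, the matrix I − P + e β^T is invertible, H = (I − P + e β^T)^{-1} − e π^T, and H satisfies H A H = H and (I − P) H = I − e π^T. -/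
open Matrix

theorem stmt_10 {m : ℕ} (hm : 1 ≤ m)
    (P : Matrix (Fin m) (Fin m) ℝ) (π : Fin m → ℝ)
    (hP0 : ∀ i j, 0 ≤ P i j)
    (hPe : P *ᵥ 1 = 1)
    (hker : ∀ x : Fin m → ℝ, (1 - P) *ᵥ x = 0 → ∃ c : ℝ, x = c • (1 : Fin m → ℝ))
    (hcoker : ∀ y : Fin m → ℝ, y ᵥ* (1 - P) = 0 → ∃ c : ℝ, y = c • π)
    (hπP : π ᵥ* P = π) (hπe : π ⬝ᵥ 1 = 1) (hπpos : ∀ i, 0 < π i)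
    (G : Matrix (Fin m) (Fin m) ℝ) (hG : (1 - P) * G * (1 - P) = 1 - P)
    (H : Matrix (Fin m) (Fin m) ℝ) (hH : H = G * (1 - vecMulVec 1 π))
    (β : Fin m → ℝ) (hβ : β = π ᵥ* (1 - G * (1 - P))) :
    (1 - P) * H * (1 - P) = 1 - P ∧
    H *ᵥ 1 = 0 ∧
    IsUnit (1 - P + vecMulVec 1 β) ∧
    H = (1 - P + vecMulVec 1 β)⁻¹ - vecMulVec 1 π ∧
    H * (1 - P) * H = H ∧
    (1 - P) * H = 1 - vecMulVec 1 π := by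
  have hAe : (1 - P) *ᵥ 1 = 0 := by rw [sub_mulVec, one_mulVec, hPe, sub_self]
  have hπA : π ᵥ* (1 - P) = 0 := by rw [vecMul_sub, vecMul_one, hπP, sub_self]
  have hπ_proj : π ᵥ* vecMulVec 1 π = π := by rw [vecMul_vecMulVec, hπe, one_smul]
  have hrow : ∃ u : Fin m → ℝ, 1 - (1 - P) * G = vecMulVec u π := by
    have hzero : (1 - (1 - P) * G) * (1 - P) = 0 := by
      rw [Matrix.sub_mul, Matrix.one_mul, hG, sub_self]
    have hscale (i : Fin m) : ∃ c : ℝ, (1 - (1 - P) * G) i = c • π :=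
      hcoker _ (congrFun hzero i)
    choose u hu using hscale
    exact ⟨u, funext hu⟩
  obtain ⟨u, hu⟩ := hrow
  have hAH : (1 - P) * H = 1 - vecMulVec 1 π := by
    have hAG : (1 - P) * G = 1 - vecMulVec u π := by rw [← hu, sub_sub_cancel]
    have hu_proj : vecMulVec u π * (1 - vecMulVec 1 π) = 0 := by
      rw [vecMulVec_mul, vecMul_sub, vecMul_one, hπ_proj, sub_self, vecMulVec_zero]
    rw [hH, ← Matrix.mul_assoc, hAG, Matrix.sub_mul, Matrix.one_mul, hu_proj, sub_zero]
  have hHe : H *ᵥ 1 = 0 := by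
    rw [hH, ← mulVec_mulVec, sub_mulVec, one_mulVec, vecMulVec_mulVec, hπe,
      MulOpposite.op_one, one_smul, sub_self, mulVec_zero]
  have hβe : β ⬝ᵥ 1 = 1 := by
    rw [hβ, ← dotProduct_mulVec, sub_mulVec, ← mulVec_mulVec, hAe, mulVec_zero, one_mulVec,
      sub_zero, hπe]
  have hβH : β ᵥ* H = 0 := by
    rw [hβ, vecMul_vecMul, Matrix.sub_mul, Matrix.one_mul, Matrix.mul_assoc, hAH, ← hH,
      sub_self, vecMul_zero]
  have hinv : (1 - P + vecMulVec 1 β) * (H + vecMulVec 1 π) = 1 := by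
    rw [Matrix.add_mul, Matrix.mul_add, Matrix.mul_add, hAH, mul_vecMulVec, hAe, zero_vecMulVec,
      add_zero, vecMulVec_mul, hβH, vecMulVec_zero, zero_add, vecMulVec_mul, vecMul_vecMulVec,
      hβe, one_smul, sub_add_cancel]
  refine ⟨?_, hHe, IsUnit.of_mul_eq_one _ hinv, ?_, ?_, hAH⟩
  · rw [hAH, Matrix.sub_mul, Matrix.one_mul, vecMulVec_mul, hπA, vecMulVec_zero, sub_zero]
  · rw [inv_eq_right_inv hinv, add_sub_cancel_right]
  · rw [Matrix.mul_assoc, hAH, Matrix.mul_sub, Matrix.mul_one, mul_vecMulVec, hHe,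
      zero_vecMulVec, sub_zero]
end

section
/- For every one-condition g-inverse G of A = I − P, the matrix (I − Π) G (I − Π) is the same, namely (I − Π) G (I − Π) = (I − P + e π^T)^{-1} − e π^T (the group inverse A^# of A). -/
/-- In a ring, if `e` is an idempotent with `a * e = 0 = e * a` and `w` is a two-sided inverse of
`a + e`, then compressing any inner inverse `g` of `a` by `1 - e` gives `w - e`. -/
theorem compress_inner_inverse_eq {R : Type*} [Ring R] {a e g w : R}
    (hee : e * e = e) (hae : a * e = 0) (hea : e * a = 0)
    (hzw : (a + e) * w = 1) (hwz : w * (a + e) = 1) (hg : a * g * a = a) :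
    (1 - e) * g * (1 - e) = w - e := by
  have hew : e * w = e := by
    calc e * w = e * (a + e) * w := by rw [mul_add, hea, hee, zero_add]
      _ = e := by rw [mul_assoc, hzw, mul_one]
  have hwe : w * e = e := by
    calc w * e = w * ((a + e) * e) := by rw [add_mul, hae, hee, zero_add]
      _ = e := by rw [← mul_assoc, hwz, one_mul]
  have haw : a * w = 1 - e := by rw [← hzw, add_mul, hew, add_sub_cancel_right]
  have hwa : w * a = 1 - e := by rw [← hwz, mul_add, hwe, add_sub_cancel_right]
  calc (1 - e) * g * (1 - e) = w * (a * g * a) * w := by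
        rw [← hwa, mul_assoc, mul_assoc, hwa, ← haw]; simp only [mul_assoc]
      _ = w - e := by rw [hg, hwa, sub_mul, one_mul, hew]

open Matrix

theorem stmt_11 {m : ℕ} (hm : 1 ≤ m)
    (P : Matrix (Fin m) (Fin m) ℝ) (π : Fin m → ℝ)
    (hP0 : ∀ i j, 0 ≤ P i j)
    (hPe : P *ᵥ 1 = 1)
    (hker : ∀ x : Fin m → ℝ, (1 - P) *ᵥ x = 0 → ∃ c : ℝ, x = c • (1 : Fin m → ℝ))
    (hcoker : ∀ y : Fin m → ℝ, y ᵥ* (1 - P) = 0 → ∃ c : ℝ, y = c • π)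
    (hπP : π ᵥ* P = π) (hπe : π ⬝ᵥ 1 = 1) (hπpos : ∀ i, 0 < π i)
    (G : Matrix (Fin m) (Fin m) ℝ) (hG : (1 - P) * G * (1 - P) = 1 - P) :
    (1 - vecMulVec 1 π) * G * (1 - vecMulVec 1 π) =
      (1 - P + vecMulVec 1 π)⁻¹ - vecMulVec 1 π := by
  have hee : vecMulVec (1 : Fin m → ℝ) π * vecMulVec (1 : Fin m → ℝ) π = vecMulVec (1 : Fin m → ℝ) π := by
    rw [vecMulVec_mul_vecMulVec, hπe, one_smul]
  have hae : (1 - P) * vecMulVec (1 : Fin m → ℝ) π = 0 := by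
    rw [mul_vecMulVec, sub_mulVec, one_mulVec, hPe, sub_self, zero_vecMulVec]
  have hea : vecMulVec (1 : Fin m → ℝ) π * (1 - P) = 0 := by
    rw [vecMulVec_mul, vecMul_sub, vecMul_one, hπP, sub_self, vecMulVec_zero]
  have hdet : IsUnit (1 - P + vecMulVec (1 : Fin m → ℝ) π).det := by
    rw [← isUnit_iff_isUnit_det, ← mulVec_injective_iff_isUnit, ← coe_mulVecLin,
      injective_iff_map_eq_zero]
    intro x hx
    rw [mulVecLin_apply] at hx
    have hex : vecMulVec (1 : Fin m → ℝ) π *ᵥ x = 0 := by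
      have h := congrArg (vecMulVec (1 : Fin m → ℝ) π *ᵥ ·) hx
      simpa only [mulVec_mulVec, mul_add, hea, hee, zero_add, mulVec_zero] using h
    obtain ⟨c, rfl⟩ := hker x (by rwa [add_mulVec, hex, add_zero] at hx)
    rwa [mulVec_smul, vecMulVec_mulVec, hπe, MulOpposite.op_one, one_smul] at hex
  exact compress_inner_inverse_eq hee hae hea (mul_nonsing_inv _ hdet) (nonsing_inv_mul _ hdet) hG
end

section
/- Let G be a one-condition g-inverse of A = I − P and set A_G = I − (I − P) G. Then A_G e ≠ 0, and for every row vector v^T with v^T A_G e ≠ 0, one has π^T = (v^T A_G) / (v^T A_G e). -/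
open Matrix

theorem stmt_12 {m : ℕ} (hm : 1 ≤ m)
    (P : Matrix (Fin m) (Fin m) ℝ) (π : Fin m → ℝ)
    (hP0 : ∀ i j, 0 ≤ P i j)
    (hPe : P *ᵥ 1 = 1)
    (hker : ∀ x : Fin m → ℝ, (1 - P) *ᵥ x = 0 → ∃ c : ℝ, x = c • (1 : Fin m → ℝ))
    (hcoker : ∀ y : Fin m → ℝ, y ᵥ* (1 - P) = 0 → ∃ c : ℝ, y = c • π)
    (hπP : π ᵥ* P = π) (hπe : π ⬝ᵥ 1 = 1) (hπpos : ∀ i, 0 < π i)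
    (G : Matrix (Fin m) (Fin m) ℝ) (hG : (1 - P) * G * (1 - P) = 1 - P)
    (AG : Matrix (Fin m) (Fin m) ℝ) (hAG : AG = 1 - (1 - P) * G) :
    AG *ᵥ 1 ≠ 0 ∧
    ∀ v : Fin m → ℝ, v ⬝ᵥ (AG *ᵥ 1) ≠ 0 →
      π = (1 / (v ⬝ᵥ (AG *ᵥ 1))) • (v ᵥ* AG) := by
  have hπA : π ᵥ* (1 - P) = 0 := by rw [vecMul_sub, vecMul_one, hπP, sub_self]
  have hπAG : π ᵥ* AG = π := by
    rw [hAG, vecMul_sub, vecMul_one, ← vecMul_vecMul, hπA, zero_vecMul, sub_zero]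
  have hAGA : AG * (1 - P) = 0 := by
    rw [hAG, Matrix.sub_mul, Matrix.one_mul, hG, sub_self]
  refine ⟨fun h => ?_, fun v hv => ?_⟩
  · have h1 : π ⬝ᵥ (AG *ᵥ 1) = 1 := by rw [dotProduct_mulVec, hπAG, hπe]
    rw [h, dotProduct_zero] at h1
    exact zero_ne_one h1
  · obtain ⟨c, hc⟩ := hcoker (v ᵥ* AG) (by rw [vecMul_vecMul, hAGA, vecMul_zero])
    have hvc : v ⬝ᵥ (AG *ᵥ 1) = c := by
      rw [dotProduct_mulVec, hc, smul_dotProduct, hπe, smul_eq_mul, mul_one]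
    rw [hvc] at hv ⊢
    rw [hc, smul_smul, one_div_mul_cancel hv, one_smul]
end

section
/- Let G be a one-condition g-inverse of A = I − P, let E be the all-ones matrix, D = diag(1/π_1, …, 1/π_m), and for a matrix X let X_d denote the diagonal matrix of the diagonal entries of X. Then the matrix M := [G Π − E (G Π)_d + I − G + E G_d] D is the mean first passage time matrix: it satisfies M_d = D and (I − P) M = E − P M_d, i.e., m_{jj} = 1/π_j for all j and m_{ij} = 1 + Σ_{k≠j} p_{ik} m_{kj} for all i, j. -/
open Matrix

/-- If the left kernel of `A` is spanned by `v` with `v ⬝ᵥ u = 1`, and `A * G * A = A`, then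
`A * G` fixes `u vᵀ - 1`. -/
theorem mul_ginverse_mul_vecMulVec_sub_one {n R : Type*} [Fintype n] [DecidableEq n] [CommRing R]
    {A G : Matrix n n R} {u v : n → R} (hG : A * G * A = A)
    (hA : ∀ y : n → R, y ᵥ* A = 0 → ∃ c : R, y = c • v) (hvu : v ⬝ᵥ u = 1) :
    A * G * (vecMulVec u v - 1) = vecMulVec u v - 1 := by
  have hzero : (1 - A * G) * A = 0 := by rw [sub_mul, one_mul, hG, sub_self]
  have hrow (i : n) : ∃ c : R, (1 - A * G) i = c • v := hA _ <| by
    rw [← mul_apply_eq_vecMul, hzero]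
    rfl
  choose c hc using hrow
  have hrank : 1 - A * G = vecMulVec c v := by
    ext i j
    rw [hc i]
    rfl
  have hann : (1 - A * G) * (vecMulVec u v - 1) = 0 := by
    rw [mul_sub, mul_one, hrank, vecMulVec_mul_vecMulVec, hvu, one_smul, sub_self]
  rw [sub_mul, one_mul, sub_eq_zero] at hann
  exact hann.symm

theorem stmt_13 {m : ℕ} (hm : 1 ≤ m)
    (P : Matrix (Fin m) (Fin m) ℝ) (π : Fin m → ℝ)
    (hP0 : ∀ i j, 0 ≤ P i j)
    (hPe : P *ᵥ 1 = 1)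
    (hker : ∀ x : Fin m → ℝ, (1 - P) *ᵥ x = 0 → ∃ c : ℝ, x = c • (1 : Fin m → ℝ))
    (hcoker : ∀ y : Fin m → ℝ, y ᵥ* (1 - P) = 0 → ∃ c : ℝ, y = c • π)
    (hπP : π ᵥ* P = π) (hπe : π ⬝ᵥ 1 = 1) (hπpos : ∀ i, 0 < π i)
    (G : Matrix (Fin m) (Fin m) ℝ) (hG : (1 - P) * G * (1 - P) = 1 - P)
    (E D M : Matrix (Fin m) (Fin m) ℝ)
    (hE : E = Matrix.of fun _ _ => (1 : ℝ))
    (hD : D = Matrix.diagonal fun i => 1 / π i)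
    (hM : M = (G * vecMulVec 1 π
        - E * Matrix.diagonal (fun i => (G * vecMulVec 1 π : Matrix (Fin m) (Fin m) ℝ) i i)
        + 1 - G + E * Matrix.diagonal fun i => G i i) * D) :
    Matrix.diagonal (fun i => M i i) = D ∧
    (1 - P) * M = E - P * Matrix.diagonal (fun i => M i i) ∧
    (∀ j, M j j = 1 / π j) ∧
    (∀ i j, M i j = 1 + ∑ k ∈ Finset.univ.erase j, P i k * M k j) := by
  have hEv : E = vecMulVec 1 1 := by
    rw [hE]
    ext i j
    simp [vecMulVec_apply]
  have hdiag (j : Fin m) : M j j = 1 / π j := by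
    rw [hM, hD, mul_diagonal]
    simp [hEv, mul_diagonal]
  have hMd : diagonal (fun i => M i i) = D := by
    rw [hD]
    exact congrArg diagonal (funext hdiag)
  have hAE : (1 - P) * E = 0 := by
    rw [hEv, mul_vecMulVec, sub_mulVec, one_mulVec, hPe, sub_self, zero_vecMulVec]
  have h_statD : vecMulVec 1 π * D = E := by
    rw [hD, hEv]
    ext i j
    simp [mul_diagonal, vecMulVec_apply, (hπpos j).ne']
  have hfix := mul_ginverse_mul_vecMulVec_sub_one hG hcoker hπe
  have hAM : (1 - P) * M = E - P * diagonal (fun i => M i i) := by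
    rw [hMd, ← h_statD, ← sub_mul, hM, ← mul_assoc]
    congr 1
    simp only [mul_add, mul_sub, ← mul_assoc, hAE, zero_mul, mul_one] at hfix ⊢
    linear_combination (norm := abel) hfix
  refine ⟨hMd, hAM, hdiag, fun i j => ?_⟩
  have hij := congrFun₂ hAM i j
  rw [sub_mul, one_mul, Matrix.sub_apply, Matrix.sub_apply, mul_diagonal, mul_apply, hE, of_apply,
    ← Finset.add_sum_erase _ _ (Finset.mem_univ j)] at hij
  linarith
end

section
/- Let G be a one-condition g-inverse of A = I − P, let M be the mean first passage time matrix, let E be the all-ones matrix, D = diag(1/π_1, …, 1/π_m), and G_d the diagonal matrix of the diagonal entries of G. Then M = [I − G + E G_d] D if and only if there exists a scalar g with G e = g e. -/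
open Matrix

/-- The defect of `A * G` from the identity has all rows proportional to `π`. -/
theorem exists_mul_eq_one_add_vecMulVec {m : ℕ} {A G : Matrix (Fin m) (Fin m) ℝ} {π : Fin m → ℝ}
    (hcoker : ∀ y : Fin m → ℝ, y ᵥ* A = 0 → ∃ c : ℝ, y = c • π) (hG : A * G * A = A) :
    ∃ c : Fin m → ℝ, A * G = 1 + vecMulVec c π := by
  have h0 : (A * G - 1) * A = 0 := by rw [sub_mul, hG, one_mul, sub_self]
  have hrow : ∀ i, ∃ c : ℝ, (A * G - 1) i = c • π := fun i =>
    hcoker _ (by ext j; simpa [Matrix.mul_apply, vecMul, dotProduct] using congrFun₂ h0 i j)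
  choose c hc using hrow
  refine ⟨c, ?_⟩
  rw [← sub_eq_iff_eq_add']
  ext i j
  rw [hc]
  simp [vecMulVec_apply]

/-- If the kernel of `A` consists of constant vectors, a matrix is determined by its image under
left multiplication by `A` together with its diagonal. -/
theorem eq_of_mul_eq_of_diag_eq {m : ℕ} {A M X : Matrix (Fin m) (Fin m) ℝ}
    (hker : ∀ x : Fin m → ℝ, A *ᵥ x = 0 → ∃ c : ℝ, x = c • (1 : Fin m → ℝ))
    (hA : A * M = A * X) (hd : ∀ j, M j j = X j j) : M = X := by
  have h0 : A * (M - X) = 0 := by rw [mul_sub, hA, sub_self]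
  ext i j
  obtain ⟨c, hc⟩ := hker (fun k => (M - X) k j)
    (by ext i; simpa [Matrix.mul_apply, mulVec, dotProduct] using congrFun₂ h0 i j)
  have h1 := congrFun hc i
  have h2 := congrFun hc j
  simp [hd] at h1 h2
  linarith

theorem stmt_14 {m : ℕ} (hm : 1 ≤ m)
    (P : Matrix (Fin m) (Fin m) ℝ) (π : Fin m → ℝ)
    (hP0 : ∀ i j, 0 ≤ P i j)
    (hPe : P *ᵥ 1 = 1)
    (hker : ∀ x : Fin m → ℝ, (1 - P) *ᵥ x = 0 → ∃ c : ℝ, x = c • (1 : Fin m → ℝ))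
    (hcoker : ∀ y : Fin m → ℝ, y ᵥ* (1 - P) = 0 → ∃ c : ℝ, y = c • π)
    (hπP : π ᵥ* P = π) (hπe : π ⬝ᵥ 1 = 1) (hπpos : ∀ i, 0 < π i)
    (G : Matrix (Fin m) (Fin m) ℝ) (hG : (1 - P) * G * (1 - P) = 1 - P)
    (M : Matrix (Fin m) (Fin m) ℝ)
    (hMd : ∀ j, M j j = 1 / π j)
    (hMij : ∀ i j, M i j = 1 + ∑ k ∈ Finset.univ.erase j, P i k * M k j)
    (E D : Matrix (Fin m) (Fin m) ℝ)
    (hE : E = Matrix.of fun _ _ => (1 : ℝ))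
    (hD : D = Matrix.diagonal fun i => 1 / π i) :
    M = (1 - G + E * Matrix.diagonal fun i => G i i) * D ↔
      ∃ g : ℝ, G *ᵥ 1 = g • (1 : Fin m → ℝ) := by
  have hAM : (1 - P) * M = E - P * D := by
    ext i j
    have h := Finset.add_sum_erase Finset.univ (fun k => P i k * M k j) (Finset.mem_univ j)
    have hij := hMij i j
    rw [sub_mul, one_mul, hE, hD]
    simp only [Matrix.sub_apply, Matrix.mul_diagonal, Matrix.of_apply]
    rw [Matrix.mul_apply, ← h, ← hMd j]
    linarith
  obtain ⟨c, hc⟩ := exists_mul_eq_one_add_vecMulVec hcoker hG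
  have hA1 : (1 - P) *ᵥ (1 : Fin m → ℝ) = 0 := by
    rw [sub_mulVec, one_mulVec, hPe, sub_self]
  have hAE : (1 - P) * E = 0 := by
    ext i j
    rw [hE, Matrix.mul_apply]
    exact congrFun hA1 i
  have hπD : vecMulVec c π * D = vecMulVec c 1 := by
    ext i j
    have := (hπpos j).ne'
    simp [hD, vecMulVec_apply, Matrix.mul_diagonal, this]
  have hAX : (1 - P) * ((1 - G + E * Matrix.diagonal fun i => G i i) * D)
      = -vecMulVec c 1 - P * D := by
    rw [← mul_assoc, mul_add, ← mul_assoc, hAE, mul_sub, hc, ← hπD]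
    noncomm_ring
  have hAG : (1 - P) *ᵥ (G *ᵥ 1) = 1 + c := by
    rw [mulVec_mulVec, hc, add_mulVec, one_mulVec]
    ext i
    simp [vecMulVec_mulVec, hπe]
  constructor
  · intro hM
    refine hker _ ?_
    rw [← hM, hAM] at hAX
    rw [hAG]
    ext i
    have h := congrFun₂ hAX i i
    simp [hE] at h
    simp only [Pi.add_apply, Pi.one_apply, Pi.zero_apply]
    linarith
  · rintro ⟨g, hg⟩
    rw [hg, mulVec_smul, hA1, smul_zero] at hAG
    refine eq_of_mul_eq_of_diag_eq hker ?_ fun j => ?_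
    · rw [hAM, hAX]
      congr 1
      ext i j
      have h := congrFun hAG i
      simp only [Pi.add_apply, Pi.one_apply, Pi.zero_apply] at h
      simp [hE]
      linarith
    · simp [hMd, hE, hD, Matrix.mul_diagonal]
end

section
/- Let M = [m_{ij}] be the mean first passage time matrix, let A^# = [a^#_{ij}] = (I − P + Π)^{-1} − Π be the group inverse of A = I − P, and for each j set τ_j = Σ_{k=1}^m π_k m_{kj}. Then for all j, a^#_{jj} = π_j (τ_j − 1), and for all i ≠ j, a^#_{ij} = π_j (τ_j − 1 − m_{ij}) = a^#_{jj} − π_j m_{ij}. -/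
open Matrix

variable {n K : Type*} [Fintype n] [DecidableEq n] [Field K]

/-- The mean first passage equations, written for the matrix `M - diagonal π⁻¹` obtained from the
mean first passage matrix `M` by replacing its diagonal with zeros. -/
theorem one_sub_mul_offDiag_meanFirstPassage {P M : Matrix n n K} {π : n → K}
    (hMd : ∀ j, M j j = 1 / π j)
    (hM : ∀ i j, M i j = 1 + ∑ k ∈ Finset.univ.erase j, P i k * M k j) :
    (1 - P) * (M - diagonal π⁻¹) = vecMulVec 1 1 - diagonal π⁻¹ := by
  ext i j
  have hsum : ∑ k ∈ Finset.univ.erase j, P i k * M k j + P i j * M j j = (P * M) i j :=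
    Finset.sum_erase_add _ (fun k => P i k * M k j) (Finset.mem_univ j)
  have hij := hM i j
  rw [hMd j, one_div] at hsum
  simp only [sub_mul, one_mul, mul_sub, Matrix.sub_apply, mul_diagonal, vecMulVec_apply, Pi.one_apply,
    Pi.inv_apply]
  linear_combination hij + hsum

/-- The fundamental matrix `(1 - P + Π)⁻¹` in terms of mean first passage times. -/
theorem inv_one_sub_add_stationary_eq {P M : Matrix n n K} {π : n → K}
    (hP : P *ᵥ 1 = 1) (hπe : π ⬝ᵥ 1 = 1) (hπ : ∀ i, π i ≠ 0)
    (hMd : ∀ j, M j j = 1 / π j)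
    (hM : ∀ i j, M i j = 1 + ∑ k ∈ Finset.univ.erase j, P i k * M k j) :
    (1 - P + vecMulVec 1 π)⁻¹ =
      vecMulVec 1 (π * (π ᵥ* M)) - (M - diagonal π⁻¹) * diagonal π := by
  have hD : diagonal π⁻¹ * diagonal π = (1 : Matrix n n K) := by
    simp [diagonal_mul_diagonal, hπ]
  have hfix : (1 - P + vecMulVec 1 π) *ᵥ 1 = 1 := by
    rw [add_mulVec, sub_mulVec, one_mulVec, hP, sub_self, zero_add, vecMulVec_mulVec, hπe]
    simp
  have hN : (1 - P + vecMulVec 1 π) * (M - diagonal π⁻¹) =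
      vecMulVec 1 (π ᵥ* M) - diagonal π⁻¹ := by
    rw [add_mul, one_sub_mul_offDiag_meanFirstPassage hMd hM, vecMulVec_mul]
    ext i j
    simp [vecMul_sub, vecMul_diagonal, hπ]
  apply inv_eq_right_inv
  rw [mul_sub, ← mul_assoc, hN, mul_vecMulVec, hfix, sub_mul, hD]
  ext i j
  simp [mul_comm]

theorem stmt_15 {m : ℕ} (hm : 1 ≤ m)
    (P : Matrix (Fin m) (Fin m) ℝ) (π : Fin m → ℝ)
    (hP0 : ∀ i j, 0 ≤ P i j)
    (hPe : P *ᵥ 1 = 1)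
    (hker : ∀ x : Fin m → ℝ, (1 - P) *ᵥ x = 0 → ∃ c : ℝ, x = c • (1 : Fin m → ℝ))
    (hcoker : ∀ y : Fin m → ℝ, y ᵥ* (1 - P) = 0 → ∃ c : ℝ, y = c • π)
    (hπP : π ᵥ* P = π) (hπe : π ⬝ᵥ 1 = 1) (hπpos : ∀ i, 0 < π i)
    (M : Matrix (Fin m) (Fin m) ℝ)
    (hMd : ∀ j, M j j = 1 / π j)
    (hMij : ∀ i j, M i j = 1 + ∑ k ∈ Finset.univ.erase j, P i k * M k j)
    (Asharp : Matrix (Fin m) (Fin m) ℝ)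
    (hAsharp : Asharp = (1 - P + vecMulVec 1 π)⁻¹ - vecMulVec 1 π)
    (τ : Fin m → ℝ) (hτ : ∀ j, τ j = ∑ k, π k * M k j) :
    (∀ j, Asharp j j = π j * (τ j - 1)) ∧
    (∀ i j, i ≠ j →
      Asharp i j = π j * (τ j - 1 - M i j) ∧
      Asharp i j = Asharp j j - π j * M i j) := by
  obtain rfl : τ = π ᵥ* M := funext hτ
  have hπ i : π i ≠ 0 := (hπpos i).ne'
  rw [inv_one_sub_add_stationary_eq hPe hπe hπ hMd hMij] at hAsharp
  have hdiag j : Asharp j j = π j * ((π ᵥ* M) j - 1) := by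
    simp [hAsharp, hMd]
    ring
  have hoff i j (hij : i ≠ j) : Asharp i j = π j * ((π ᵥ* M) j - 1 - M i j) := by
    simp [hAsharp, diagonal_apply_ne _ hij]
    ring
  refine ⟨hdiag, fun i j hij => ⟨hoff i j hij, ?_⟩⟩
  rw [hoff i j hij, hdiag]
  ring
end

section
/- Let 𝓔 be a matrix with 𝓔 e = 0 such that P̄ = P + 𝓔 is the transition matrix of an irreducible Markov chain with stationary probability vector π̄^T. Let G be any one-condition g-inverse of A = I − P and set H = G (I − Π). Then π̄^T − π^T = π̄^T 𝓔 H. -/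
open Matrix

theorem stmt_16 {m : ℕ} (hm : 1 ≤ m)
    (P : Matrix (Fin m) (Fin m) ℝ) (π : Fin m → ℝ)
    (hP0 : ∀ i j, 0 ≤ P i j)
    (hPe : P *ᵥ 1 = 1)
    (hker : ∀ x : Fin m → ℝ, (1 - P) *ᵥ x = 0 → ∃ c : ℝ, x = c • (1 : Fin m → ℝ))
    (hcoker : ∀ y : Fin m → ℝ, y ᵥ* (1 - P) = 0 → ∃ c : ℝ, y = c • π)
    (hπP : π ᵥ* P = π) (hπe : π ⬝ᵥ 1 = 1) (hπpos : ∀ i, 0 < π i)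
    (Ep : Matrix (Fin m) (Fin m) ℝ) (πb : Fin m → ℝ)
    (hEpe : Ep *ᵥ 1 = 0)
    (hPb0 : ∀ i j, 0 ≤ (P + Ep) i j)
    (hPbe : (P + Ep) *ᵥ 1 = 1)
    (hkerb : ∀ x : Fin m → ℝ, (1 - (P + Ep)) *ᵥ x = 0 → ∃ c : ℝ, x = c • (1 : Fin m → ℝ))
    (hcokerb : ∀ y : Fin m → ℝ, y ᵥ* (1 - (P + Ep)) = 0 → ∃ c : ℝ, y = c • πb)
    (hπbP : πb ᵥ* (P + Ep) = πb) (hπbe : πb ⬝ᵥ 1 = 1) (hπbpos : ∀ i, 0 < πb i)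
    (G : Matrix (Fin m) (Fin m) ℝ) (hG : (1 - P) * G * (1 - P) = 1 - P)
    (H : Matrix (Fin m) (Fin m) ℝ) (hH : H = G * (1 - vecMulVec 1 π)) :
    πb - π = πb ᵥ* (Ep * H) := by
  have hE : πb ᵥ* Ep = πb ᵥ* (1 - P) := by
    rw [vecMul_add] at hπbP
    rw [vecMul_sub, vecMul_one]
    exact eq_sub_of_add_eq' hπbP
  have hproj (v : Fin m → ℝ) : v ᵥ* (1 - vecMulVec 1 π) = v - (v ⬝ᵥ 1) • π := by
    rw [vecMul_sub, vecMul_one, vecMul_vecMulVec]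
  obtain ⟨c, hc⟩ := hcoker (πb ᵥ* ((1 - P) * G) - πb) (by
    rw [sub_vecMul, vecMul_vecMul, hG, sub_self])
  rw [hH, ← vecMul_vecMul, hE, vecMul_vecMul, ← Matrix.mul_assoc, ← vecMul_vecMul,
    eq_add_of_sub_eq hc, add_vecMul, smul_vecMul, hproj, hproj, hπe, hπbe]
  simp
end

section
/- Let 𝓔 be a matrix with 𝓔 e = 0 such that P̄ = P + 𝓔 is the transition matrix of an irreducible Markov chain with stationary probability vector π̄^T, and let A^# = (I − P + Π)^{-1} − Π be the group inverse of A = I − P. Then the matrix I − 𝓔 A^# is invertible and π̄^T = π^T (I − 𝓔 A^#)^{-1}. -/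
open Matrix

/-- A stationary vector `μ` of `Q` with coordinate sum one is mapped to `π` by
`1 - Q + 1 πᵀ`. -/
theorem vecMul_one_sub_add_vecMulVec_one {n K : Type*} [Fintype n] [DecidableEq n] [CommRing K]
    {Q : Matrix n n K} {μ : n → K} (hμQ : μ ᵥ* Q = μ) (hμ : μ ⬝ᵥ 1 = 1) (π : n → K) :
    μ ᵥ* (1 - Q + vecMulVec 1 π) = π := by
  rw [vecMul_add, vecMul_sub, vecMul_one, hμQ, sub_self, zero_add, vecMul_vecMulVec, hμ,
    one_smul]

/-- If `μ` is a stationary vector of `Q` and the kernel of `1 - Q` is spanned by the all-ones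
vector, then `1 - Q + 1 πᵀ` is invertible for every `π` with coordinate sum one. -/
theorem isUnit_one_sub_add_vecMulVec_one {n K : Type*} [Fintype n] [DecidableEq n] [Field K]
    {Q : Matrix n n K} {μ π : n → K}
    (hker : ∀ x : n → K, (1 - Q) *ᵥ x = 0 → ∃ c : K, x = c • (1 : n → K))
    (hμQ : μ ᵥ* Q = μ) (hμ : μ ⬝ᵥ 1 = 1) (hπ : π ⬝ᵥ 1 = 1) :
    IsUnit (1 - Q + vecMulVec 1 π) := by
  rw [← mulVec_injective_iff_isUnit]
  refine (injective_iff_map_eq_zero (mulVecLin (1 - Q + vecMulVec 1 π))).2 fun x hx => ?_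
  rw [mulVecLin_apply] at hx
  have hπx : π ⬝ᵥ x = 0 := by
    rw [← vecMul_one_sub_add_vecMulVec_one hμQ hμ π, ← dotProduct_mulVec, hx, dotProduct_zero]
  obtain ⟨c, rfl⟩ := hker x (by
    rwa [add_mulVec, vecMulVec_mulVec, hπx, MulOpposite.op_zero, zero_smul, add_zero] at hx)
  rw [dotProduct_smul, hπ, smul_eq_mul, mul_one] at hπx
  rw [hπx, zero_smul]

theorem vecMul_nonsing_inv_eq_of_vecMul_eq {n K : Type*} [Fintype n] [DecidableEq n] [CommRing K]
    {M : Matrix n n K} {v w : n → K} (hM : IsUnit M) (h : v ᵥ* M = w) : w ᵥ* M⁻¹ = v := by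
  rw [← h, vecMul_vecMul, mul_nonsing_inv _ ((isUnit_iff_isUnit_det _).1 hM), vecMul_one]

theorem stmt_17 {m : ℕ} (hm : 1 ≤ m)
    (P : Matrix (Fin m) (Fin m) ℝ) (π : Fin m → ℝ)
    (hP0 : ∀ i j, 0 ≤ P i j)
    (hPe : P *ᵥ 1 = 1)
    (hker : ∀ x : Fin m → ℝ, (1 - P) *ᵥ x = 0 → ∃ c : ℝ, x = c • (1 : Fin m → ℝ))
    (hcoker : ∀ y : Fin m → ℝ, y ᵥ* (1 - P) = 0 → ∃ c : ℝ, y = c • π)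
    (hπP : π ᵥ* P = π) (hπe : π ⬝ᵥ 1 = 1) (hπpos : ∀ i, 0 < π i)
    (Ep : Matrix (Fin m) (Fin m) ℝ) (πb : Fin m → ℝ)
    (hEpe : Ep *ᵥ 1 = 0)
    (hPb0 : ∀ i j, 0 ≤ (P + Ep) i j)
    (hPbe : (P + Ep) *ᵥ 1 = 1)
    (hkerb : ∀ x : Fin m → ℝ, (1 - (P + Ep)) *ᵥ x = 0 → ∃ c : ℝ, x = c • (1 : Fin m → ℝ))
    (hcokerb : ∀ y : Fin m → ℝ, y ᵥ* (1 - (P + Ep)) = 0 → ∃ c : ℝ, y = c • πb)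
    (hπbP : πb ᵥ* (P + Ep) = πb) (hπbe : πb ⬝ᵥ 1 = 1) (hπbpos : ∀ i, 0 < πb i)
    (Asharp : Matrix (Fin m) (Fin m) ℝ)
    (hAsharp : Asharp = (1 - P + vecMulVec 1 π)⁻¹ - vecMulVec 1 π) :
    IsUnit (1 - Ep * Asharp) ∧ πb = π ᵥ* (1 - Ep * Asharp)⁻¹ := by
  have hZ : IsUnit (1 - P + vecMulVec 1 π) :=
    isUnit_one_sub_add_vecMulVec_one hker hπP hπe hπe
  have hN : IsUnit (1 - (P + Ep) + vecMulVec 1 π) :=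
    isUnit_one_sub_add_vecMulVec_one hkerb hπbP hπbe hπe
  have hfactor : 1 - Ep * Asharp =
      (1 - (P + Ep) + vecMulVec 1 π) * (1 - P + vecMulVec 1 π)⁻¹ := by
    have hsub : 1 - (P + Ep) + vecMulVec 1 π = (1 - P + vecMulVec 1 π) - Ep := by abel
    rw [hsub, sub_mul, mul_nonsing_inv _ ((isUnit_iff_isUnit_det _).1 hZ), hAsharp, mul_sub, mul_vecMulVec, hEpe,
      zero_vecMulVec, sub_zero]
  have hunit : IsUnit (1 - Ep * Asharp) := by
    rw [hfactor]
    exact hN.mul ((isUnit_nonsing_inv_iff).2 hZ)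
  have hπbN : πb ᵥ* (1 - (P + Ep) + vecMulVec 1 π) = π :=
    vecMul_one_sub_add_vecMulVec_one hπbP hπbe π
  have hπZinv : π ᵥ* (1 - P + vecMulVec 1 π)⁻¹ = π :=
    vecMul_nonsing_inv_eq_of_vecMul_eq hZ (vecMul_one_sub_add_vecMulVec_one hπP hπe π)
  have hπb : πb ᵥ* (1 - Ep * Asharp) = π := by
    rw [hfactor, ← vecMul_vecMul, hπbN, hπZinv]
  exact ⟨hunit, (vecMul_nonsing_inv_eq_of_vecMul_eq hunit hπb).symm⟩
end

section
/- Let a and b be column vectors with b^T e = 0, and suppose 𝓔 = a b^T is such that P̄ = P + 𝓔 is the transition matrix of an irreducible Markov chain with stationary probability vector π̄^T. Let G be a one-condition g-inverse of A = I − P satisfying G e = g e for some scalar g, and set w^T = b^T G. Then det(I − 𝓔 G) = 1 − w^T a = 1 − b^T (I − P + e π^T)^{-1} a ≠ 0, the matrix I − 𝓔 G is invertible with (I − 𝓔 G)^{-1} = I + (a w^T)/(1 − w^T a), and π̄^T = π^T (I + (a w^T)/(1 − w^T a)). -/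
open Matrix

namespace Matrix

variable {n K : Type*} [Fintype n] [Field K]

/-- If the kernel of `A` is spanned by the all-ones vector, then a row vector orthogonal to that
vector is fixed by `G * A` for every one-condition g-inverse `G` of `A`. -/
theorem vecMul_vecMul_of_mul_mul_eq {A G : Matrix n n K}
    (hker : ∀ x : n → K, A *ᵥ x = 0 → ∃ c : K, x = c • (1 : n → K))
    (hG : A * G * A = A) {b : n → K} (hb : b ⬝ᵥ 1 = 0) : b ᵥ* G ᵥ* A = b := by
  refine dotProduct_eq _ _ fun x => ?_
  obtain ⟨c, hc⟩ := hker ((G * A) *ᵥ x - x) (by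
    rw [mulVec_sub, mulVec_mulVec, ← mul_assoc, hG, sub_self])
  rw [vecMul_vecMul, ← dotProduct_mulVec, sub_eq_iff_eq_add.mp hc, dotProduct_add,
    dotProduct_smul, hb, smul_zero, zero_add]

variable [DecidableEq n]

theorem det_one_sub_vecMulVec (u v : n → K) : (1 - vecMulVec u v).det = 1 - v ⬝ᵥ u := by
  rw [vecMulVec_eq Unit, det_one_sub_mul_comm, det_unique]
  simp [mul_apply, dotProduct]

theorem inv_one_sub_vecMulVec {u v : n → K} (h : 1 - v ⬝ᵥ u ≠ 0) :
    (1 - vecMulVec u v)⁻¹ = 1 + (1 - v ⬝ᵥ u)⁻¹ • vecMulVec u v := by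
  refine inv_eq_right_inv ?_
  rw [sub_mul, one_mul, mul_add, mul_one, mul_smul_comm, vecMulVec_mul_vecMulVec, vecMulVec_smul]
  ext i j
  simp only [sub_apply, add_apply, smul_apply, smul_eq_mul]
  field_simp
  ring

theorem isUnit_det_add_vecMulVec_one {A : Matrix n n K} {π : n → K}
    (hker : ∀ x : n → K, A *ᵥ x = 0 → ∃ c : K, x = c • (1 : n → K))
    (hπA : π ᵥ* A = 0) (hπ : π ⬝ᵥ 1 = 1) : IsUnit (A + vecMulVec 1 π).det := by
  rw [isUnit_iff_ne_zero]
  intro h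
  obtain ⟨x, hx, hZx⟩ := exists_mulVec_eq_zero_iff.mpr h
  have hπx : π ⬝ᵥ x = 0 := by
    have := congrArg (π ⬝ᵥ ·) hZx
    simpa [dotProduct_mulVec, vecMul_add, hπA, vecMul_vecMulVec, hπ, -one_vecMulVec] using this
  obtain ⟨c, hc⟩ := hker x (by
    simpa [add_mulVec, vecMulVec_mulVec, hπx, -one_vecMulVec] using hZx)
  have hc0 : c = 0 := by simpa [hc, dotProduct_smul, hπ] using hπx
  exact hx (by rw [hc, hc0, zero_smul])

end Matrix

theorem stmt_18 {m : ℕ} (hm : 1 ≤ m)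
    (P : Matrix (Fin m) (Fin m) ℝ) (π : Fin m → ℝ)
    (hP0 : ∀ i j, 0 ≤ P i j)
    (hPe : P *ᵥ 1 = 1)
    (hker : ∀ x : Fin m → ℝ, (1 - P) *ᵥ x = 0 → ∃ c : ℝ, x = c • (1 : Fin m → ℝ))
    (hcoker : ∀ y : Fin m → ℝ, y ᵥ* (1 - P) = 0 → ∃ c : ℝ, y = c • π)
    (hπP : π ᵥ* P = π) (hπe : π ⬝ᵥ 1 = 1) (hπpos : ∀ i, 0 < π i)
    (a b : Fin m → ℝ) (hb : b ⬝ᵥ 1 = 0)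
    (Ep : Matrix (Fin m) (Fin m) ℝ) (hEp : Ep = vecMulVec a b)
    (πb : Fin m → ℝ)
    (hEpe : Ep *ᵥ 1 = 0)
    (hPb0 : ∀ i j, 0 ≤ (P + Ep) i j)
    (hPbe : (P + Ep) *ᵥ 1 = 1)
    (hkerb : ∀ x : Fin m → ℝ, (1 - (P + Ep)) *ᵥ x = 0 → ∃ c : ℝ, x = c • (1 : Fin m → ℝ))
    (hcokerb : ∀ y : Fin m → ℝ, y ᵥ* (1 - (P + Ep)) = 0 → ∃ c : ℝ, y = c • πb)
    (hπbP : πb ᵥ* (P + Ep) = πb) (hπbe : πb ⬝ᵥ 1 = 1) (hπbpos : ∀ i, 0 < πb i)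
    (G : Matrix (Fin m) (Fin m) ℝ) (hG : (1 - P) * G * (1 - P) = 1 - P)
    (g : ℝ) (hGe : G *ᵥ 1 = g • (1 : Fin m → ℝ))
    (w : Fin m → ℝ) (hw : w = b ᵥ* G) :
    (1 - Ep * G).det = 1 - w ⬝ᵥ a ∧
    1 - w ⬝ᵥ a = 1 - b ⬝ᵥ ((1 - P + vecMulVec 1 π)⁻¹ *ᵥ a) ∧
    1 - w ⬝ᵥ a ≠ 0 ∧
    IsUnit (1 - Ep * G) ∧
    (1 - Ep * G)⁻¹ = 1 + (1 - w ⬝ᵥ a)⁻¹ • vecMulVec a w ∧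
    πb = π ᵥ* (1 + (1 - w ⬝ᵥ a)⁻¹ • vecMulVec a w) := by
  have hEG : Ep * G = vecMulVec a w := by rw [hEp, hw, vecMulVec_mul]
  have hπA : π ᵥ* (1 - P) = 0 := by rw [vecMul_sub, vecMul_one, hπP, sub_self]
  have hw1 : w ⬝ᵥ 1 = 0 := by
    rw [hw, ← dotProduct_mulVec, hGe, dotProduct_smul, hb, smul_zero]
  have hwA : w ᵥ* (1 - P) = b := by
    rw [hw]
    exact vecMul_vecMul_of_mul_mul_eq hker hG hb
  have hpert (y : Fin m → ℝ) :
      y ᵥ* (1 - (P + Ep)) = y ᵥ* (1 - P) - (y ⬝ᵥ a) • b := by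
    rw [← sub_sub, vecMul_sub, hEp, vecMul_vecMulVec]
  have hne : 1 - w ⬝ᵥ a ≠ 0 := by
    intro h
    have hwa : w ⬝ᵥ a = 1 := by linarith
    obtain ⟨c, hc⟩ := hcokerb w (by rw [hpert, hwA, hwa, one_smul, sub_self])
    have hc0 : c = 0 := by simpa [hc, smul_dotProduct, hπbe] using hw1
    simp [hc, hc0] at hwa
  have hdet : (1 - Ep * G).det = 1 - w ⬝ᵥ a := by
    rw [hEG, det_one_sub_vecMulVec]
  have hZ : IsUnit (1 - P + vecMulVec 1 π).det :=
    isUnit_det_add_vecMulVec_one hker hπA hπe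
  have hwZ : w = b ᵥ* (1 - P + vecMulVec 1 π)⁻¹ := by
    have h : w ᵥ* (1 - P + vecMulVec 1 π) = b := by
      rw [vecMul_add, hwA, vecMul_vecMulVec, hw1, zero_smul, add_zero]
    rw [← h, vecMul_vecMul, mul_nonsing_inv _ hZ, vecMul_one]
  refine ⟨hdet, ?_, hne, ?_, ?_, ?_⟩
  · rw [dotProduct_mulVec, ← hwZ]
  · rw [isUnit_iff_isUnit_det, hdet]
    exact hne.isUnit
  · rw [hEG]
    exact inv_one_sub_vecMulVec hne
  · set y := π ᵥ* (1 + (1 - w ⬝ᵥ a)⁻¹ • vecMulVec a w) with hy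
    have hy' : y = π + ((1 - w ⬝ᵥ a)⁻¹ * (π ⬝ᵥ a)) • w := by
      rw [hy, vecMul_add, vecMul_one, vecMul_smul, vecMul_vecMulVec, smul_smul]
    obtain ⟨c, hc⟩ := hcokerb y (by
      rw [hpert, hy', add_vecMul, smul_vecMul, hπA, hwA, zero_add, ← sub_smul,
        add_dotProduct, smul_dotProduct, smul_eq_mul]
      convert zero_smul ℝ b using 2
      field_simp
      ring)
    have hy1 : y ⬝ᵥ 1 = 1 := by
      rw [hy', add_dotProduct, smul_dotProduct, hw1, hπe, smul_zero, add_zero]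
    have hc1 : c = 1 := by simpa [hc, smul_dotProduct, hπbe] using hy1
    rw [hc, hc1, one_smul]
end

section
/- Let 𝓔 be a matrix with 𝓔 e = 0 such that P̄ = P + 𝓔 is the transition matrix of an irreducible Markov chain with stationary probability vector π̄^T. Let A^# = (I − P + Π)^{-1} − Π be the group inverse of A = I − P and let Ā^# = (I − P̄ + e π̄^T)^{-1} − e π̄^T be the group inverse of Ā = I − P̄ = A − 𝓔. Then Ā^# = A^# (I − 𝓔 A^#)^{-1} − Π (I − 𝓔 A^#)^{-1} A^# (I − 𝓔 A^#)^{-1}. -/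
open Matrix

/-- If the kernel of `A` is spanned by the constant vectors and `p` is a normalised left null vector
of `A`, then adding the rank-one matrix `1 qᵀ` with `qᵀ 1 = 1` makes `A` invertible. -/
theorem isUnit_det_add_vecMulVec_one {n : Type*} [Fintype n] [DecidableEq n]
    {K : Type*} [Field K] {A : Matrix n n K} {p q : n → K}
    (hker : ∀ x : n → K, A *ᵥ x = 0 → ∃ c : K, x = c • (1 : n → K))
    (hpA : p ᵥ* A = 0) (hp : p ⬝ᵥ 1 = 1) (hq : q ⬝ᵥ 1 = 1) :
    IsUnit (A + vecMulVec 1 q).det := by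
  rw [isUnit_iff_ne_zero]
  intro hdet
  obtain ⟨x, hx0, hx⟩ := exists_mulVec_eq_zero_iff.mpr hdet
  rw [add_mulVec, vecMulVec_mulVec] at hx
  have hqx : q ⬝ᵥ x = 0 := by
    have h := congrArg (p ⬝ᵥ ·) hx
    simpa [dotProduct_add, dotProduct_mulVec, hpA, hp] using h
  obtain ⟨c, rfl⟩ := hker x (by simpa [hqx] using hx)
  rw [dotProduct_smul, hq] at hqx
  exact hx0 (by simp_all)

/-- The perturbation identity for group inverses, in terms of the ring-theoretic relations between
`A`, `B = A - E` and the projections `Q`, `R` onto their kernels; here `Z`, `W`, `Y` are the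
inverses of `A + Q`, `B + Q`, `B + R`. -/
theorem group_inverse_perturbation {S : Type*} [Ring S] {A B E Q R Z W Y : S}
    (hB : B = A - E) (hAQ : A * Q = 0) (hQA : Q * A = 0) (hBQ : B * Q = 0) (hBR : B * R = 0)
    (hRB : R * B = 0) (hQQ : Q * Q = Q) (hRR : R * R = R) (hRQ : R * Q = Q)
    (hZ : (A + Q) * Z = 1) (hZ' : Z * (A + Q) = 1) (hW : (B + Q) * W = 1)
    (hY' : Y * (B + R) = 1) :
    (1 - E * (Z - Q)) * ((A + Q) * W) = 1 ∧
      Y - R = (Z - Q) * ((A + Q) * W) - Q * ((A + Q) * W) * (Z - Q) * ((A + Q) * W) := by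
  have hEQ : E * Q = 0 := by
    have h := hBQ
    rwa [hB, sub_mul, hAQ, zero_sub, neg_eq_zero] at h
  have hfac : 1 - E * (Z - Q) = (B + Q) * Z := by
    rw [mul_sub, hEQ, sub_zero, ← hZ, hB]
    noncomm_ring
  have hQW : Q * ((A + Q) * W) = R := by
    have h : R * (B + Q) = Q := by rw [mul_add, hRB, hRQ, zero_add]
    calc Q * ((A + Q) * W) = Q * W := by rw [← mul_assoc, mul_add, hQA, hQQ, zero_add]
      _ = R * ((B + Q) * W) := by rw [← mul_assoc, h]
      _ = R := by rw [hW, mul_one]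
  have hGW : (Z - Q) * ((A + Q) * W) = W - R := by
    rw [sub_mul, hQW, ← mul_assoc, hZ', one_mul]
  have hYR : Y * R = R := by
    have h : (B + R) * R = R := by rw [add_mul, hBR, hRR, zero_add]
    calc Y * R = Y * ((B + R) * R) := by rw [h]
      _ = R := by rw [← mul_assoc, hY', one_mul]
  have hYQ : Y * Q = Q := by rw [← hRQ, ← mul_assoc, hYR]
  have hYB : Y * B = 1 - R := by
    rw [eq_sub_iff_add_eq, ← hY', mul_add, hYR]
  refine ⟨?_, ?_⟩
  · rw [hfac, mul_assoc, ← mul_assoc Z, hZ', one_mul, hW]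
  · have h : (Y - R) * (B + Q) = 1 - R := by
      rw [sub_mul, mul_add, mul_add, hYB, hYQ, hRB, hRQ]
      noncomm_ring
    calc Y - R = (Y - R) * ((B + Q) * W) := by rw [hW, mul_one]
      _ = W - R * W := by rw [← mul_assoc, h, sub_mul, one_mul]
      _ = _ := by
        rw [hQW, mul_assoc, hGW, mul_sub, hRR]
        noncomm_ring

theorem stmt_19 {m : ℕ} (hm : 1 ≤ m)
    (P : Matrix (Fin m) (Fin m) ℝ) (π : Fin m → ℝ)
    (hP0 : ∀ i j, 0 ≤ P i j)
    (hPe : P *ᵥ 1 = 1)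
    (hker : ∀ x : Fin m → ℝ, (1 - P) *ᵥ x = 0 → ∃ c : ℝ, x = c • (1 : Fin m → ℝ))
    (hcoker : ∀ y : Fin m → ℝ, y ᵥ* (1 - P) = 0 → ∃ c : ℝ, y = c • π)
    (hπP : π ᵥ* P = π) (hπe : π ⬝ᵥ 1 = 1) (hπpos : ∀ i, 0 < π i)
    (Ep : Matrix (Fin m) (Fin m) ℝ) (πb : Fin m → ℝ)
    (hEpe : Ep *ᵥ 1 = 0)
    (hPb0 : ∀ i j, 0 ≤ (P + Ep) i j)
    (hPbe : (P + Ep) *ᵥ 1 = 1)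
    (hkerb : ∀ x : Fin m → ℝ, (1 - (P + Ep)) *ᵥ x = 0 → ∃ c : ℝ, x = c • (1 : Fin m → ℝ))
    (hcokerb : ∀ y : Fin m → ℝ, y ᵥ* (1 - (P + Ep)) = 0 → ∃ c : ℝ, y = c • πb)
    (hπbP : πb ᵥ* (P + Ep) = πb) (hπbe : πb ⬝ᵥ 1 = 1) (hπbpos : ∀ i, 0 < πb i)
    (Asharp : Matrix (Fin m) (Fin m) ℝ)
    (hAsharp : Asharp = (1 - P + vecMulVec 1 π)⁻¹ - vecMulVec 1 π)
    (Absharp : Matrix (Fin m) (Fin m) ℝ)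
    (hAbsharp : Absharp = (1 - (P + Ep) + vecMulVec 1 πb)⁻¹ - vecMulVec 1 πb) :
    Absharp = Asharp * (1 - Ep * Asharp)⁻¹
      - vecMulVec 1 π * (1 - Ep * Asharp)⁻¹ * Asharp * (1 - Ep * Asharp)⁻¹ := by
  have hAe : (1 - P) *ᵥ 1 = 0 := by rw [sub_mulVec, one_mulVec, hPe, sub_self]
  have hπA : π ᵥ* (1 - P) = 0 := by rw [vecMul_sub, vecMul_one, hπP, sub_self]
  have hBe : (1 - (P + Ep)) *ᵥ 1 = 0 := by rw [sub_mulVec, one_mulVec, hPbe, sub_self]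
  have hπB : πb ᵥ* (1 - (P + Ep)) = 0 := by rw [vecMul_sub, vecMul_one, hπbP, sub_self]
  have hZ := isUnit_det_add_vecMulVec_one hker hπA hπe hπe
  have hW := isUnit_det_add_vecMulVec_one hkerb hπB hπbe hπe
  have hY := isUnit_det_add_vecMulVec_one hkerb hπB hπbe hπbe
  have hmul {p q : Fin m → ℝ} (hp : p ⬝ᵥ 1 = 1) :
      (vecMulVec 1 p * vecMulVec 1 q : Matrix (Fin m) (Fin m) ℝ) = vecMulVec 1 q := by
    rw [vecMulVec_mul_vecMulVec, hp, one_smul]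
  obtain ⟨hinv, heq⟩ := group_inverse_perturbation (sub_add_eq_sub_sub 1 P Ep)
    (by rw [mul_vecMulVec, hAe, zero_vecMulVec]) (by rw [vecMulVec_mul, hπA, vecMulVec_zero])
    (by rw [mul_vecMulVec, hBe, zero_vecMulVec]) (by rw [mul_vecMulVec, hBe, zero_vecMulVec])
    (by rw [vecMulVec_mul, hπB, vecMulVec_zero])
    (hmul hπe) (hmul hπbe) (hmul hπbe)
    (mul_nonsing_inv _ hZ) (nonsing_inv_mul _ hZ) (mul_nonsing_inv _ hW)
    (nonsing_inv_mul _ hY)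
  rw [hAbsharp, hAsharp, inv_eq_right_inv hinv]
  exact heq
end
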